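/- Let α ∈ (0,1] and C ≥ 0 be reals, let (γ_t)_{t≥0} be a real sequence with 0 ≤ γ_t ≤ 1 for all t such that the partial sums ∑_{k=0}^t γ_k tend to +∞ as t → ∞ while ∑_{k=0}^∞ γ_k² converges, and let (h_t)_{t≥0} and (g_t)_{t≥0} be sequences of nonnegative reals satisfying α γ_k g_k ≤ h_k − h_{k+1} + γ_k² C / 2 for all k ≥ 0. Then min_{0 ≤ k ≤ t} g_k → 0 as t → ∞. -/

import Mathlib

open Filter

/-- With nonnegative weights, the minimum times the total weight is at most the weighted sum. -/
lemma Finset.inf'_mul_sum_le_sum_mul {ι : Type*} {s : Finset ι} (hs : s.Nonempty)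
    (w f : ι → ℝ) (hw : ∀ i ∈ s, 0 ≤ w i) :
    s.inf' hs f * ∑ i ∈ s, w i ≤ ∑ i ∈ s, w i * f i := by
  rw [mul_comm, Finset.sum_mul]
  exact Finset.sum_le_sum fun i hi =>
    mul_le_mul_of_nonneg_left (Finset.inf'_le f hi) (hw i hi)

/-- Consequence of Theorem 3: if the step sizes `γ_t ∈ [0,1]` are non-summable but
square-summable, then the running minimum of the duality-gap sequence tends to 0. -/
theorem stmt_14 (α C : ℝ) (hα0 : 0 < α) (hα1 : α ≤ 1) (hC : 0 ≤ C)
    (γ h g : ℕ → ℝ) (hγ0 : ∀ t, 0 ≤ γ t) (hγ1 : ∀ t, γ t ≤ 1)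
    (hdiv : Tendsto (fun t : ℕ => ∑ k ∈ Finset.range (t + 1), γ k) atTop atTop)
    (hsq : Summable (fun k : ℕ => (γ k) ^ 2))
    (hh : ∀ t, 0 ≤ h t) (hg : ∀ t, 0 ≤ g t)
    (hrec : ∀ k, α * γ k * g k ≤ h k - h (k + 1) + (γ k) ^ 2 * C / 2) :
    Tendsto
      (fun t : ℕ =>
        (Finset.range (t + 1)).inf' (Finset.nonempty_range_iff.mpr (Nat.succ_ne_zero t)) g)
      atTop (nhds 0) := by
  have sum_le (t : ℕ) : α * ∑ k ∈ Finset.range (t + 1), γ k * g k ≤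
      h 0 + (∑' k, γ k ^ 2) * C / 2 := by
    calc α * ∑ k ∈ Finset.range (t + 1), γ k * g k
        = ∑ k ∈ Finset.range (t + 1), α * γ k * g k := by
          simp only [Finset.mul_sum, mul_assoc]
      _ ≤ ∑ k ∈ Finset.range (t + 1), (h k - h (k + 1) + γ k ^ 2 * C / 2) :=
          Finset.sum_le_sum fun k _ => hrec k
      _ = h 0 - h (t + 1) + (∑ k ∈ Finset.range (t + 1), γ k ^ 2) * C / 2 := by
          rw [Finset.sum_add_distrib, Finset.sum_range_sub', Finset.sum_mul, Finset.sum_div]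
      _ ≤ h 0 + (∑' k, γ k ^ 2) * C / 2 := by
          have hpartial := hsq.sum_le_tsum (Finset.range (t + 1)) fun k _ => sq_nonneg (γ k)
          have := mul_le_mul_of_nonneg_right hpartial hC
          linarith [hh (t + 1)]
  refine squeeze_zero' (Eventually.of_forall fun t => Finset.le_inf' _ _ fun k _ => hg k) ?_
    (hdiv.const_div_atTop ((h 0 + (∑' k, γ k ^ 2) * C / 2) / α))
  filter_upwards [hdiv.eventually_gt_atTop 0] with t ht
  rw [le_div_iff₀ ht, le_div_iff₀' hα0]
  exact (mul_le_mul_of_nonneg_left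
    (Finset.inf'_mul_sum_le_sum_mul _ γ g fun k _ => hγ0 k) hα0.le).trans (sum_le t)
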